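/- Let c > 0, M, G be real numbers, define λ_k = 3/(c(k+2)) and η_k = 1/((k+2)(k+1)), and let (a_k)_{k≥0} be a sequence of nonnegative real numbers satisfying, for every natural number k, a_{k+1} ≤ (1 − cλ_k + η_k) a_k + η_k G² + 2λ_k² M² + 2η_k² G². Then a_k → 0 as k → ∞. -/

import Mathlib

/-- Averaging step size `λ_k = 3/(c(k+2))`. -/
noncomputable def lamK (c : ℝ) (k : ℕ) : ℝ := 3 / (c * ((k : ℝ) + 2))

/-- MA-Echo step size `η_k = 1/((k+2)(k+1))`. -/
noncomputable def etaK (k : ℕ) : ℝ := 1 / (((k : ℝ) + 2) * ((k : ℝ) + 1))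

/-- The recursion coefficient simplifies to `k² η_k`. -/
theorem one_sub_mul_lamK_add_etaK {c : ℝ} (hc : c ≠ 0) (k : ℕ) :
    1 - c * lamK c k + etaK k = (k : ℝ) ^ 2 * etaK k := by
  have h1 : (k : ℝ) + 1 ≠ 0 := by positivity
  have h2 : (k : ℝ) + 2 ≠ 0 := by positivity
  unfold lamK etaK
  field_simp
  ring

theorem etaK_nonneg (k : ℕ) : 0 ≤ etaK k := by
  unfold etaK
  positivity

theorem two_mul_etaK_le_one (k : ℕ) : 2 * etaK k ≤ 1 := by
  have hk : (0 : ℝ) ≤ k := k.cast_nonneg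
  rw [etaK, mul_one_div, div_le_one (by positivity)]
  nlinarith

theorem lamK_sq_le {c : ℝ} (hc : 0 < c) (k : ℕ) :
    lamK c k ^ 2 ≤ 9 / c ^ 2 * etaK k := by
  have h : lamK c k ^ 2 = 9 / c ^ 2 * (1 / (((k : ℝ) + 2) * ((k : ℝ) + 2))) := by
    unfold lamK
    field_simp
    norm_num
  rw [h, etaK]
  gcongr
  norm_num

/-- A nonnegative-noise recursion with contraction factor `k² η_k` decays like `C / (k + 1)`. -/
theorem le_div_of_le_etaK_mul {C : ℝ} (hC : 0 ≤ C) {a : ℕ → ℝ}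
    (h : ∀ k : ℕ, a (k + 1) ≤ etaK k * ((k : ℝ) ^ 2 * a k + C)) (k : ℕ) :
    a (k + 1) ≤ C / ((k : ℝ) + 2) := by
  induction k with
  | zero => simpa [etaK, div_eq_inv_mul] using h 0
  | succ k ih =>
    have key : ((k + 1 : ℕ) : ℝ) ^ 2 * a (k + 1) + C ≤ ((k : ℝ) + 2) * C := by
      have h1 : ((k : ℝ) + 1) ^ 2 * a (k + 1) ≤ ((k : ℝ) + 1) ^ 2 * (C / ((k : ℝ) + 2)) := by
        gcongr
      have h2 : ((k : ℝ) + 1) ^ 2 * (C / ((k : ℝ) + 2)) ≤ ((k : ℝ) + 1) * C := by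
        rw [← mul_div_assoc, div_le_iff₀ (by positivity)]
        nlinarith [mul_nonneg (by positivity : (0 : ℝ) ≤ (k : ℝ) + 1) hC]
      push_cast
      linarith
    calc a (k + 1 + 1) ≤ etaK (k + 1) * (((k + 1 : ℕ) : ℝ) ^ 2 * a (k + 1) + C) := h (k + 1)
      _ ≤ etaK (k + 1) * (((k : ℝ) + 2) * C) := mul_le_mul_of_nonneg_left key (etaK_nonneg _)
      _ = C / (((k + 1 : ℕ) : ℝ) + 2) := by
        unfold etaK
        push_cast
        have h3 : (k : ℝ) + 1 + 1 = k + 2 := by ring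
        rw [h3]
        field_simp

/-- Proposition 2 (convergence): any nonnegative sequence satisfying the one-step recursion
`a_{k+1} ≤ (1 − cλ_k + η_k) a_k + η_k G² + 2λ_k² M² + 2η_k² G²` tends to `0`. -/
theorem stmt_17 (c M G : ℝ) (hc : 0 < c) (a : ℕ → ℝ) (ha : ∀ k, 0 ≤ a k)
    (hrec : ∀ k : ℕ, a (k + 1) ≤ (1 - c * lamK c k + etaK k) * a k
      + etaK k * G ^ 2 + 2 * lamK c k ^ 2 * M ^ 2 + 2 * etaK k ^ 2 * G ^ 2) :
    Filter.Tendsto a Filter.atTop (nhds 0) := by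
  have hC : 0 ≤ 2 * G ^ 2 + 18 / c ^ 2 * M ^ 2 := by positivity
  have hbound := le_div_of_le_etaK_mul hC (a := a) fun k => by
    have h := hrec k
    rw [one_sub_mul_lamK_add_etaK hc.ne'] at h
    have h1 := mul_le_mul_of_nonneg_right (lamK_sq_le hc k) (sq_nonneg M)
    have h2 := mul_le_mul_of_nonneg_right (two_mul_etaK_le_one k)
      (mul_nonneg (etaK_nonneg k) (sq_nonneg G))
    have h3 : 18 / c ^ 2 = 2 * (9 / c ^ 2) := by ring
    rw [h3]
    linarith
  rw [← Filter.tendsto_add_atTop_iff_nat 1]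
  refine squeeze_zero (fun k => ha (k + 1)) hbound (Filter.Tendsto.const_div_atTop ?_ _)
  exact Filter.tendsto_atTop_add_const_right _ _ tendsto_natCast_atTop_atTop
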